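/- Let h : (0,1) → ℝ be defined by h(Q) = Q^{−1/24} · ∏_{n=1}^∞ (1 − Q^{4n−3})(1 − Q^{4n−1}). Then h is differentiable at Q = e^{−π} and h′(e^{−π}) = −e^{π} Γ(1/4)⁴ / (32 · 2^{7/8} · π³), where Γ is the Gamma function. -/

import Mathlib

open Real

/-- `h(Q) = Q^{-1/24} (Q; Q⁴)_∞ (Q³; Q⁴)_∞`. -/
noncomputable def h (Q : ℝ) : ℝ :=
  Q ^ (-(1 : ℝ) / 24) *
    ∏' n : ℕ, (1 - Q ^ (4 * n + 1)) * (1 - Q ^ (4 * n + 3))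

section Theta

open Filter Topology Finset

/-- The theta series `∑ q ^ n²` over the integers. -/
noncomputable def theta (q : ℝ) : ℝ := ∑' n : ℤ, q ^ n.natAbs ^ 2

lemma summable_pow_natAbs_sq {r : ℝ} (h0 : 0 ≤ r) (h1 : r < 1) :
    Summable fun n : ℤ => r ^ n.natAbs ^ 2 := by
  have key : Summable fun n : ℕ => r ^ n ^ 2 :=
    (summable_geometric_of_lt_one h0 h1).of_nonneg_of_le (fun n => by positivity)
      (fun n => pow_le_pow_of_le_one h0 h1.le (Nat.le_self_pow two_ne_zero n))
  exact Summable.of_nat_of_neg (by simpa using key) (by simpa using key)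

lemma summable_norm_theta {q : ℝ} (hq : |q| < 1) :
    Summable fun n : ℤ => ‖q ^ n.natAbs ^ 2‖ := by
  simpa using summable_pow_natAbs_sq (abs_nonneg q) hq

/-- Gaussian binomial coefficients. -/
noncomputable def gaussBinom (Q : ℝ) : ℕ → ℕ → ℝ
  | _, 0 => 1
  | 0, _ + 1 => 0
  | N + 1, k + 1 => gaussBinom Q N k + Q ^ (k + 1) * gaussBinom Q N (k + 1)

lemma gaussBinom_eq_zero (Q : ℝ) : ∀ {N k : ℕ}, N < k → gaussBinom Q N k = 0
  | _, 0, h => by omega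
  | 0, k + 1, _ => by simp [gaussBinom]
  | N + 1, k + 1, h => by
    rw [gaussBinom, gaussBinom_eq_zero Q (by omega), gaussBinom_eq_zero Q (by omega)]; simp

/-- The finite product `(Q; Q)_n`. -/
noncomputable def qPoch (Q : ℝ) (n : ℕ) : ℝ := ∏ i ∈ range n, (1 - Q ^ (i + 1))

lemma qPoch_succ (Q : ℝ) (n : ℕ) : qPoch Q (n + 1) = qPoch Q n * (1 - Q ^ (n + 1)) := by
  rw [qPoch, prod_range_succ, qPoch]

lemma gaussBinom_mul_qPoch (Q : ℝ) : ∀ k m : ℕ,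
    gaussBinom Q (k + m) k * (qPoch Q k * qPoch Q m) = qPoch Q (k + m)
  | 0, m => by simp [gaussBinom, qPoch]
  | k + 1, 0 => by
    have := gaussBinom_mul_qPoch Q k 0
    have h1 : qPoch Q 0 = 1 := by simp [qPoch]
    rw [add_zero, h1] at this
    rw [add_zero, h1]
    rw [gaussBinom, gaussBinom_eq_zero Q (Nat.lt_succ_self k), qPoch_succ]
    linear_combination (1 - Q ^ (k + 1)) * this
  | k + 1, m + 1 => by
    have h1 := gaussBinom_mul_qPoch Q k (m + 1)
    have h2 := gaussBinom_mul_qPoch Q (k + 1) m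
    have e1 : k + (m + 1) = k + 1 + m := by ring
    rw [e1] at h1
    rw [← add_assoc, gaussBinom, qPoch_succ Q (k + 1 + m)]
    calc _ = gaussBinom Q (k + 1 + m) k * (qPoch Q k * qPoch Q (m + 1)) * (1 - Q ^ (k + 1))
          + Q ^ (k + 1) * (gaussBinom Q (k + 1 + m) (k + 1) * (qPoch Q (k + 1) * qPoch Q m))
            * (1 - Q ^ (m + 1)) := by
          rw [qPoch_succ Q k, qPoch_succ Q m]; ring
      _ = _ := by rw [h1, h2]; ring

lemma prod_add_mul_pow_eq_sum (q x y : ℝ) (N : ℕ) :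
    ∏ k ∈ range N, (y + x * q ^ (2 * k + 1)) =
      ∑ k ∈ range (N + 1), gaussBinom (q ^ 2) N k * q ^ k ^ 2 * x ^ k * y ^ (N - k) := by
  induction N generalizing x with
  | zero => simp [gaussBinom]
  | succ N ih =>
    rw [prod_range_succ']
    have : ∀ k ∈ range N, y + x * q ^ (2 * (k + 1) + 1) = y + x * q ^ 2 * q ^ (2 * k + 1) := by
      intro k _; ring
    rw [prod_congr rfl this, ih, sum_range_succ' _ (N + 1), mul_add, mul_comm _ y]
    have h1 : y * ∑ k ∈ range (N + 1), gaussBinom (q ^ 2) N k * q ^ k ^ 2 * (x * q ^ 2) ^ k *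
        y ^ (N - k) = ∑ k ∈ range (N + 1), q ^ (2 * (k + 1)) * gaussBinom (q ^ 2) N (k + 1) *
          q ^ (k + 1) ^ 2 * x ^ (k + 1) * y ^ (N - k) + y ^ (N + 1) := by
      rw [sum_range_succ', mul_add, sum_range_succ _ N, gaussBinom_eq_zero _ (Nat.lt_succ_self N),
        mul_sum]
      simp only [mul_zero, zero_mul, add_zero, gaussBinom]
      congr 1
      · refine sum_congr rfl fun k hk => ?_
        obtain ⟨m, rfl⟩ : ∃ m, N = k + 1 + m := ⟨N - (k + 1), by have := mem_range.1 hk; omega⟩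
        have e1 : k + 1 + m - (k + 1) = m := by omega
        have e2 : k + 1 + m - k = m + 1 := by omega
        rw [e1, e2]; ring
      · simp; ring
    rw [h1, sum_mul, add_right_comm, ← sum_add_distrib]
    congr 1
    · refine sum_congr rfl fun k _ => ?_
      rw [gaussBinom, Nat.succ_sub_succ]; ring
    · simp [gaussBinom]

lemma prod_sq_eq_sum {q : ℝ} (hq : q ≠ 0) (n : ℕ) :
    (∏ k ∈ range n, (1 + q ^ (2 * k + 1))) ^ 2 =
      ∑ k ∈ range (2 * n + 1), gaussBinom (q ^ 2) (2 * n) k * q ^ ((k : ℤ) - n).natAbs ^ 2 := by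
  have h := prod_add_mul_pow_eq_sum q 1 (q ^ (2 * n)) (2 * n)
  have hL : ∏ k ∈ range (2 * n), (q ^ (2 * n) + 1 * q ^ (2 * k + 1)) =
      q ^ (3 * n ^ 2) * (∏ k ∈ range n, (1 + q ^ (2 * k + 1))) ^ 2 := by
    rw [two_mul n, prod_range_add, ← prod_range_reflect, sq, ← mul_assoc]
    have a1 : ∏ j ∈ range n, (q ^ (n + n) + 1 * q ^ (2 * (n - 1 - j) + 1)) =
        q ^ (n ^ 2) * ∏ k ∈ range n, (1 + q ^ (2 * k + 1)) := by
      have hs : ∀ n, ∏ j ∈ range n, q ^ (2 * (n - 1 - j) + 1) = q ^ (n ^ 2) := by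
        intro n
        rw [prod_range_reflect (fun j => q ^ (2 * j + 1)) n]
        induction n with
        | zero => simp
        | succ n ih => rw [prod_range_succ, ih]; ring
      rw [← hs, ← prod_mul_distrib]
      refine prod_congr rfl fun j hj => ?_
      have : n + n = (2 * (n - 1 - j) + 1) + (2 * j + 1) := by have := mem_range.1 hj; omega
      rw [this, pow_add _ (2 * (n - 1 - j) + 1)]; ring
    have a2 : ∏ j ∈ range n, (q ^ (n + n) + 1 * q ^ (2 * (n + j) + 1)) =
        q ^ (2 * n ^ 2) * ∏ k ∈ range n, (1 + q ^ (2 * k + 1)) := by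
      have hs : q ^ (2 * n ^ 2) = ∏ j ∈ range n, q ^ (n + n) := by
        rw [prod_const, card_range, ← pow_mul]; congr 1; ring
      rw [hs, ← prod_mul_distrib]
      refine prod_congr rfl fun j hj => ?_
      ring
    rw [a1, a2]; ring
  rw [hL] at h
  have hq' : q ^ (3 * n ^ 2) ≠ 0 := pow_ne_zero _ hq
  apply mul_left_cancel₀ hq'
  rw [h, mul_sum]
  refine sum_congr rfl fun k hk => ?_
  have hk' : k ≤ 2 * n := by have := mem_range.1 hk; omega
  have : k ^ 2 + 2 * n * (2 * n - k) = 3 * n ^ 2 + ((k : ℤ) - n).natAbs ^ 2 := by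
    zify [hk']; rw [sq_abs]; ring
  rw [one_pow, mul_one, mul_assoc, ← pow_mul, ← pow_add, this, pow_add]; ring

/-- The infinite product `(Q; Q)_∞`. -/
noncomputable def eulerProd (Q : ℝ) : ℝ := ∏' i : ℕ, (1 - Q ^ (i + 1))

lemma summable_norm_pow_mul_add {q : ℝ} (hq : |q| < 1) (a b : ℕ) (ha : a ≠ 0) :
    Summable fun i : ℕ => ‖q ^ (a * i + b)‖ := by
  have h : Summable fun i : ℕ => |q| ^ b * (|q| ^ a) ^ i :=
    (summable_geometric_of_lt_one (by positivity)
      (pow_lt_one₀ (abs_nonneg q) hq ha)).mul_left _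
  refine h.congr fun i => ?_
  rw [norm_pow, Real.norm_eq_abs, pow_add, pow_mul, mul_comm]

lemma qPoch_tendsto {Q : ℝ} (h0 : 0 ≤ Q) (h1 : Q < 1) :
    Tendsto (qPoch Q) atTop (𝓝 (eulerProd Q)) := by
  have : Multipliable fun i : ℕ => 1 - Q ^ (i + 1) := by
    simp_rw [sub_eq_add_neg]
    apply multipliable_one_add_of_summable
    simpa using summable_norm_pow_mul_add (abs_lt.2 ⟨by linarith, h1⟩) 1 1 one_ne_zero
  exact this.hasProd.tendsto_prod_nat

lemma one_sub_pow_pos {Q : ℝ} (h0 : 0 ≤ Q) (h1 : Q < 1) (i : ℕ) : 0 < 1 - Q ^ (i + 1) :=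
  sub_pos.2 (pow_lt_one₀ h0 h1 i.succ_ne_zero)

lemma qPoch_antitone {Q : ℝ} (h0 : 0 ≤ Q) (h1 : Q < 1) : Antitone (qPoch Q) := by
  refine antitone_nat_of_succ_le fun n => ?_
  rw [qPoch_succ]
  refine mul_le_of_le_one_right (prod_nonneg fun i _ => (one_sub_pow_pos h0 h1 i).le) ?_
  have := pow_nonneg h0 (n + 1)
  linarith

lemma qPoch_le_one {Q : ℝ} (h0 : 0 ≤ Q) (h1 : Q < 1) (n : ℕ) : qPoch Q n ≤ 1 := by
  simpa [qPoch] using qPoch_antitone h0 h1 (Nat.zero_le n)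

lemma eulerProd_le_qPoch {Q : ℝ} (h0 : 0 ≤ Q) (h1 : Q < 1) (n : ℕ) :
    eulerProd Q ≤ qPoch Q n :=
  (qPoch_antitone h0 h1).le_of_tendsto (qPoch_tendsto h0 h1) n

lemma eulerProd_pos {Q : ℝ} (h0 : 0 ≤ Q) (h1 : Q < 1) : 0 < eulerProd Q := by
  refine lt_of_le_of_ne (ge_of_tendsto' (qPoch_tendsto h0 h1) fun n =>
    prod_nonneg fun i _ => (one_sub_pow_pos h0 h1 i).le) (Ne.symm ?_)
  have := tprod_one_add_ne_zero_of_summable (f := fun i : ℕ => -Q ^ (i + 1))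
    (fun i => by have := one_sub_pow_pos h0 h1 i; linarith)
    (by simpa using summable_norm_pow_mul_add (abs_lt.2 ⟨by linarith, h1⟩) 1 1 one_ne_zero)
  simpa [eulerProd, sub_eq_add_neg] using this

lemma gaussBinom_eq_div {Q : ℝ} (h0 : 0 ≤ Q) (h1 : Q < 1) (k m : ℕ) :
    gaussBinom Q (k + m) k = qPoch Q (k + m) / (qPoch Q k * qPoch Q m) := by
  have hp : ∀ n, 0 < qPoch Q n := fun n => prod_pos fun i _ => one_sub_pow_pos h0 h1 i
  rw [eq_div_iff (mul_pos (hp k) (hp m)).ne', gaussBinom_mul_qPoch]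

lemma abs_gaussBinom_le {Q : ℝ} (h0 : 0 ≤ Q) (h1 : Q < 1) (k m : ℕ) :
    |gaussBinom Q (k + m) k| ≤ 1 / (eulerProd Q * eulerProd Q) := by
  have hp : ∀ n, 0 < qPoch Q n := fun n => prod_pos fun i _ => one_sub_pow_pos h0 h1 i
  have he := eulerProd_pos h0 h1
  rw [gaussBinom_eq_div h0 h1, abs_of_pos (div_pos (hp _) (mul_pos (hp k) (hp m)))]
  exact div_le_div₀ zero_le_one (qPoch_le_one h0 h1 _) (mul_pos he he)
    (mul_le_mul (eulerProd_le_qPoch h0 h1 k) (eulerProd_le_qPoch h0 h1 m) he.le (hp k).le)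

/-- Jacobi's product formula for the theta series, at `z = 1`. -/
lemma theta_eq_prod {q : ℝ} (hq0 : q ≠ 0) (hq : |q| < 1) :
    theta q = eulerProd (q ^ 2) * (∏' k : ℕ, (1 + q ^ (2 * k + 1))) ^ 2 := by
  have h0 : 0 ≤ q ^ 2 := sq_nonneg q
  have h1 : q ^ 2 < 1 := (sq_lt_one_iff_abs_lt_one q).2 hq
  have he := eulerProd_pos h0 h1
  have hm : Multipliable fun k : ℕ => 1 + q ^ (2 * k + 1) :=
    multipliable_one_add_of_summable (summable_norm_pow_mul_add hq 2 1 two_ne_zero)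
  have hprod := (hm.hasProd.tendsto_prod_nat).pow 2
  let F : ℕ → ℤ → ℝ := fun n j =>
    if j.natAbs ≤ n then gaussBinom (q ^ 2) (2 * n) (j + n).toNat * q ^ j.natAbs ^ 2 else 0
  have hF : ∀ n, ∑' j, F n j = (∏ k ∈ range n, (1 + q ^ (2 * k + 1))) ^ 2 := by
    intro n
    rw [prod_sq_eq_sum hq0, tsum_eq_sum (s := Finset.Icc (-n : ℤ) n)]
    · refine Finset.sum_nbij' (fun j => (j + n).toNat) (fun k => (k : ℤ) - n) ?_ ?_ ?_ ?_ ?_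
      · intro j hj; simp only [Finset.mem_Icc, Finset.mem_range] at *; omega
      · intro j hj; simp only [Finset.mem_Icc, Finset.mem_range] at *; omega
      · intro j hj; simp only [Finset.mem_Icc] at *; omega
      · intro j hj; simp
      · intro j hj
        simp only [Finset.mem_Icc] at hj
        have e : (((j + n).toNat : ℕ) : ℤ) - n = j := by omega
        simp only [F, e]
        rw [if_pos (by omega)]
    · intro j hj
      simp only [Finset.mem_Icc] at hj
      exact if_neg (by omega)
  have hlim : Tendsto (fun n => ∑' j, F n j) atTop
      (𝓝 (∑' j : ℤ, (eulerProd (q ^ 2))⁻¹ * q ^ j.natAbs ^ 2)) := by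
    refine tendsto_tsum_of_dominated_convergence
      (bound := fun j : ℤ => 1 / (eulerProd (q ^ 2) * eulerProd (q ^ 2)) * ‖q ^ j.natAbs ^ 2‖)
      ((summable_norm_theta hq).mul_left _) ?_ ?_
    · intro j
      have hev : (fun n : ℕ => qPoch (q ^ 2) (2 * n) / (qPoch (q ^ 2) (j + n).toNat *
          qPoch (q ^ 2) (n - j).toNat) * q ^ j.natAbs ^ 2) =ᶠ[atTop] fun n => F n j := by
        filter_upwards [eventually_ge_atTop j.natAbs] with n hn
        simp only [F]
        rw [if_pos hn]
        have e : 2 * n = (j + n).toNat + (n - j).toNat := by omega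
        rw [e, gaussBinom_eq_div h0 h1, ← e]
      refine Tendsto.congr' hev ?_
      have t0 := qPoch_tendsto h0 h1
      have t1 : Tendsto (fun n : ℕ => 2 * n) atTop atTop :=
        tendsto_atTop_mono (fun n => by rw [id]; omega) tendsto_id
      have t2 : Tendsto (fun n : ℕ => (j + n).toNat) atTop atTop :=
        tendsto_atTop_mono (f := fun n => n - j.natAbs) (fun n => by omega)
          (tendsto_sub_atTop_nat _)
      have t3 : Tendsto (fun n : ℕ => (n - j).toNat) atTop atTop :=
        tendsto_atTop_mono (f := fun n => n - j.natAbs) (fun n => by omega)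
          (tendsto_sub_atTop_nat _)
      have := (((t0.comp t1).div ((t0.comp t2).mul (t0.comp t3)) (mul_pos he he).ne')).mul_const
        (q ^ j.natAbs ^ 2)
      have e : (eulerProd (q ^ 2))⁻¹ = eulerProd (q ^ 2) / (eulerProd (q ^ 2) * eulerProd (q ^ 2)) := by
        field_simp
      rw [e]
      exact this
    · refine Eventually.of_forall fun n j => ?_
      simp only [F]
      split_ifs with hn
      · rw [norm_mul]
        refine mul_le_mul_of_nonneg_right ?_ (norm_nonneg _)
        have e : 2 * n = (j + n).toNat + (n - j).toNat := by omega
        rw [e]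
        exact abs_gaussBinom_le h0 h1 _ _
      · simpa using by positivity
  have := tendsto_nhds_unique (hlim.congr hF) hprod
  rw [tsum_mul_left] at this
  rw [← this, theta]
  field_simp

lemma tsum_int_prod_eq_tsum_add_sub (F : ℤ × ℤ → ℝ)
    (hF : ∀ p : ℤ × ℤ, ¬ Even (p.1 + p.2) → F p = 0) :
    ∑' p, F p = ∑' p : ℤ × ℤ, F (p.1 + p.2, p.1 - p.2) := by
  have hinj : Function.Injective fun p : ℤ × ℤ => (p.1 + p.2, p.1 - p.2) := by
    rintro ⟨a, b⟩ ⟨c, d⟩ h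
    simp only [Prod.mk.injEq] at h ⊢
    omega
  refine (hinj.tsum_eq fun p hp => ?_).symm
  have : Even (p.1 + p.2) := by
    by_contra h
    exact hp (hF p h)
  obtain ⟨u, hu⟩ := this
  exact ⟨(u, p.1 - u), by ext <;> simp; omega⟩

lemma neg_pow_natAbs_sq (q : ℝ) (n : ℤ) :
    (-q) ^ n.natAbs ^ 2 = (if Even n then 1 else -1) * q ^ n.natAbs ^ 2 := by
  rw [neg_pow]
  congr 1
  split_ifs with h
  · exact Even.neg_one_pow ((Int.natAbs_even.2 h).pow_of_ne_zero two_ne_zero)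
  · exact Odd.neg_one_pow ((Int.natAbs_odd.2 (Int.not_even_iff_odd.1 h)).pow)

lemma pow_add_sub_natAbs_sq (q : ℝ) (u v : ℤ) :
    q ^ (u + v).natAbs ^ 2 * q ^ (u - v).natAbs ^ 2 =
      (q ^ 2) ^ u.natAbs ^ 2 * (q ^ 2) ^ v.natAbs ^ 2 := by
  rw [← pow_add, ← pow_mul, ← pow_mul, ← pow_add]
  congr 1
  zify
  simp only [sq_abs]
  ring

lemma theta_mul_theta {a b : ℝ} (ha : |a| < 1) (hb : |b| < 1) :
    theta a * theta b = ∑' p : ℤ × ℤ, a ^ p.1.natAbs ^ 2 * b ^ p.2.natAbs ^ 2 :=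
  tsum_mul_tsum_of_summable_norm (summable_norm_theta ha) (summable_norm_theta hb)

lemma summable_theta_mul {a b : ℝ} (ha : |a| < 1) (hb : |b| < 1) :
    Summable fun p : ℤ × ℤ => a ^ p.1.natAbs ^ 2 * b ^ p.2.natAbs ^ 2 :=
  summable_mul_of_summable_norm (f := fun n : ℤ => a ^ n.natAbs ^ 2)
    (g := fun n : ℤ => b ^ n.natAbs ^ 2) (summable_norm_theta ha) (summable_norm_theta hb)

lemma abs_sq_lt_one {q : ℝ} (hq : |q| < 1) : |q ^ 2| < 1 := by
  rw [abs_pow]; exact pow_lt_one₀ (abs_nonneg q) hq two_ne_zero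

lemma theta_sq_add_theta_neg_sq {q : ℝ} (hq : |q| < 1) :
    theta q ^ 2 + theta (-q) ^ 2 = 2 * theta (q ^ 2) ^ 2 := by
  have hq' : |-q| < 1 := by rwa [abs_neg]
  have hq2 := abs_sq_lt_one hq
  rw [sq, sq, sq (theta (q ^ 2)), theta_mul_theta hq hq, theta_mul_theta hq' hq',
    theta_mul_theta hq2 hq2,
    ← (summable_theta_mul hq hq).tsum_add (summable_theta_mul hq' hq'),
    tsum_int_prod_eq_tsum_add_sub, ← tsum_mul_left]
  · refine tsum_congr fun p => ?_
    have hp : Even (p.1 - p.2) ↔ Even (p.1 + p.2) := by rw [Int.even_sub, Int.even_add]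
    simp only [neg_pow_natAbs_sq, hp, ← pow_add_sub_natAbs_sq]
    split_ifs <;> ring
  · intro p hp
    simp only [neg_pow_natAbs_sq]
    rw [Int.even_add] at hp
    split_ifs with h1 h2 h2
    · exact absurd (iff_of_true h1 h2) hp
    · ring
    · ring
    · exact absurd (iff_of_false h1 h2) hp

lemma theta_mul_theta_neg {q : ℝ} (hq : |q| < 1) :
    theta q * theta (-q) = theta (-q ^ 2) ^ 2 := by
  have hq' : |-q| < 1 := by rwa [abs_neg]
  have hq2 : |-q ^ 2| < 1 := by rw [abs_neg]; exact abs_sq_lt_one hq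
  have h2 : 2 * (theta q * theta (-q)) = 2 * theta (-q ^ 2) ^ 2 := by
    rw [two_mul (theta q * _), sq]
    nth_rewrite 2 [mul_comm]
    rw [theta_mul_theta hq hq', theta_mul_theta hq' hq, theta_mul_theta hq2 hq2,
      ← (summable_theta_mul hq hq').tsum_add (summable_theta_mul hq' hq),
      tsum_int_prod_eq_tsum_add_sub, ← tsum_mul_left]
    · refine tsum_congr fun p => ?_
      have hp : Even (p.1 - p.2) ↔ (Even p.1 ↔ Even p.2) := by rw [Int.even_sub]
      have hp' : Even (p.1 + p.2) ↔ (Even p.1 ↔ Even p.2) := by rw [Int.even_add]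
      have := pow_add_sub_natAbs_sq q p.1 p.2
      simp only [neg_pow_natAbs_sq, hp, hp']
      by_cases h1 : Even p.1 <;> by_cases h2 : Even p.2 <;> simp only [h1, h2] <;> simp <;>
        linarith
    · intro p hp
      simp only [neg_pow_natAbs_sq]
      rw [Int.even_add] at hp
      split_ifs with h1 h2 h2
      · exact absurd (iff_of_true h2 h1) hp
      · ring
      · ring
      · exact absurd (iff_of_false h2 h1) hp
  linarith

lemma theta_eq_re (x : ℝ) : theta x = (∑' k : ℤ, (x : ℂ) ^ k.natAbs ^ 2).re := by
  rw [theta, ← Complex.ofReal_re (∑' n : ℤ, x ^ n.natAbs ^ 2)]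
  push_cast
  rfl

lemma norm_pow_natAbs_sq_le {r : ℝ} {w : ℂ} (hw : w ∈ Metric.ball (0 : ℂ) r) (k : ℤ) :
    ‖w ^ k.natAbs ^ 2‖ ≤ r ^ k.natAbs ^ 2 := by
  rw [norm_pow]
  exact pow_le_pow_left₀ (norm_nonneg w) (mem_ball_zero_iff.1 hw).le _

lemma differentiableOn_tsum_pow_natAbs_sq {r : ℝ} (hr0 : 0 ≤ r) (hr1 : r < 1) :
    DifferentiableOn ℂ (fun z : ℂ => ∑' k : ℤ, z ^ k.natAbs ^ 2) (Metric.ball 0 r) :=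
  Complex.differentiableOn_tsum_of_summable_norm (summable_pow_natAbs_sq hr0 hr1)
    (fun k => by fun_prop) Metric.isOpen_ball fun k _ hw => norm_pow_natAbs_sq_le hw k

lemma contDiffAt_theta {q : ℝ} (hq : |q| < 1) (n : WithTop ℕ∞) : ContDiffAt ℝ n theta q := by
  obtain ⟨r, hr, hr1⟩ := exists_between hq
  have hd := differentiableOn_tsum_pow_natAbs_sq ((abs_nonneg q).trans hr.le) hr1
  have hmem : (q : ℂ) ∈ Metric.ball (0 : ℂ) r := by simpa using hr
  have hc := ((hd.analyticAt (Metric.isOpen_ball.mem_nhds hmem)).contDiffAt (n := n)).real_of_complex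
  exact hc.congr_of_eventuallyEq (Eventually.of_forall theta_eq_re)

lemma theta_zero : theta 0 = 1 := by
  rw [theta, tsum_eq_single 0]
  · simp
  · intro n hn
    simpa using hn

lemma hasDerivAt_theta_zero : HasDerivAt theta 2 0 := by
  have hmem : (0 : ℂ) ∈ Metric.ball (0 : ℂ) (1 / 2) := by simp
  have hd := (differentiableOn_tsum_pow_natAbs_sq (r := 1 / 2) (by norm_num) (by norm_num))
    |>.differentiableAt (Metric.isOpen_ball.mem_nhds hmem)
  have hs := Complex.hasSum_deriv_of_summable_norm
    (summable_pow_natAbs_sq (r := 1 / 2) (by norm_num) (by norm_num))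
    (F := fun (k : ℤ) (z : ℂ) => z ^ k.natAbs ^ 2) (fun k => by fun_prop) Metric.isOpen_ball
    (fun k _ hw => norm_pow_natAbs_sq_le hw k) hmem
  have hs' := hasSum_sum_of_ne_finset_zero (L := .unconditional ℤ) (s := ({1, -1} : Finset ℤ))
    (f := fun k : ℤ => deriv (fun z : ℂ => z ^ k.natAbs ^ 2) 0) (fun k hk => by
      simp only [Finset.mem_insert, Finset.mem_singleton, not_or] at hk
      have h1 : k.natAbs ≠ 1 := by omega
      rcases Nat.eq_zero_or_pos k.natAbs with h0 | h0
      · simp [h0]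
      · have h2 : k.natAbs ^ 2 - 1 ≠ 0 := by
          have : 1 < k.natAbs ^ 2 := one_lt_pow₀ (by omega) two_ne_zero
          omega
        simp [h2])
  have h2 := hd.hasDerivAt
  rw [hs.unique hs'] at h2
  have h3 := HasDerivAt.real_of_complex (z := 0) (by simpa using h2)
  rw [show theta = fun x : ℝ => (∑' k : ℤ, (x : ℂ) ^ k.natAbs ^ 2).re from funext theta_eq_re]
  refine h3.congr_deriv ?_
  norm_num

end Theta

section AGM

open Filter Topology
open MeasureTheory Set

/-- The complete elliptic integral computing the arithmetic-geometric mean of `a` and `b`. -/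
noncomputable def agmIntegral (a b : ℝ) : ℝ :=
  ∫ t in Ioi (0 : ℝ), 1 / (√(t ^ 2 + a ^ 2) * √(t ^ 2 + b ^ 2))

lemma agmIntegral_landen {a b : ℝ} (ha : 0 < a) (hb : 0 < b) :
    agmIntegral ((a + b) / 2) √(a * b) = agmIntegral a b := by
  have hab := mul_pos ha hb
  have key := integral_image_eq_integral_abs_deriv_smul (s := Ioi (0 : ℝ))
    (f := fun t => (t - a * b / t) / 2) (f' := fun t => (1 + a * b / t ^ 2) / 2) measurableSet_Ioi
    (fun t ht => by
      have ht' : t ≠ 0 := (mem_Ioi.1 ht).ne'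
      have := ((hasDerivAt_id t).sub ((hasDerivAt_inv ht').const_mul (a * b))).div_const 2
      refine (this.congr_deriv ?_).hasDerivWithinAt
      field_simp
      ring)
    (fun x hx y hy hxy => by
      have hx : 0 < x := hx
      have hy : 0 < y := hy
      simp only at hxy
      have h1 : (x - y) * (x * y + a * b) = 0 := by
        field_simp at hxy
        linarith
      rcases mul_eq_zero.1 h1 with h | h
      · linarith
      · have := mul_pos hx hy
        linarith)
    (fun u => 1 / (√(u ^ 2 + ((a + b) / 2) ^ 2) * √(u ^ 2 + √(a * b) ^ 2)))
  have himg : (fun t => (t - a * b / t) / 2) '' Ioi (0 : ℝ) = univ := by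
    refine eq_univ_of_forall fun u => ⟨u + √(u ^ 2 + a * b), ?_, ?_⟩
    · have : |u| < √(u ^ 2 + a * b) := by
        rw [← sqrt_sq_eq_abs]
        exact sqrt_lt_sqrt (sq_nonneg u) (by linarith)
      have := neg_abs_le u
      exact mem_Ioi.2 (by linarith)
    · have h1 : |u| < √(u ^ 2 + a * b) := by
        rw [← sqrt_sq_eq_abs]
        exact sqrt_lt_sqrt (sq_nonneg u) (by linarith)
      have h2 := neg_abs_le u
      have h3 : u + √(u ^ 2 + a * b) ≠ 0 := by linarith
      have h4 : √(u ^ 2 + a * b) ^ 2 = u ^ 2 + a * b := sq_sqrt (by positivity)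
      simp only
      field_simp
      linarith
  rw [himg, Measure.restrict_univ] at key
  have heven : ∫ u : ℝ, 1 / (√(u ^ 2 + ((a + b) / 2) ^ 2) * √(u ^ 2 + √(a * b) ^ 2)) =
      2 * agmIntegral ((a + b) / 2) √(a * b) := by
    have := integral_comp_abs
      (f := fun u : ℝ => 1 / (√(u ^ 2 + ((a + b) / 2) ^ 2) * √(u ^ 2 + √(a * b) ^ 2)))
    simpa only [sq_abs, agmIntegral] using this
  have hR : ∫ t in Ioi (0 : ℝ), |(1 + a * b / t ^ 2) / 2| •
      (1 / (√(((t - a * b / t) / 2) ^ 2 + ((a + b) / 2) ^ 2) *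
        √(((t - a * b / t) / 2) ^ 2 + √(a * b) ^ 2))) = 2 * agmIntegral a b := by
    rw [agmIntegral, ← integral_const_mul]
    refine setIntegral_congr_fun measurableSet_Ioi fun t ht => ?_
    have ht : 0 < t := ht
    have e1 : √(((t - a * b / t) / 2) ^ 2 + √(a * b) ^ 2) = (t + a * b / t) / 2 := by
      rw [sq_sqrt hab.le, ← sqrt_sq (show 0 ≤ (t + a * b / t) / 2 by positivity)]
      congr 1
      field_simp
      ring
    have e2 : √(((t - a * b / t) / 2) ^ 2 + ((a + b) / 2) ^ 2) =
        √(t ^ 2 + a ^ 2) * √(t ^ 2 + b ^ 2) / (2 * t) := by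
      rw [← sqrt_mul (by positivity), ← sqrt_sq (show 0 ≤ 2 * t by positivity),
        ← sqrt_div (by positivity)]
      congr 1
      field_simp
      ring
    have h3 : 0 < √(t ^ 2 + a ^ 2) := sqrt_pos.2 (by positivity)
    have h4 : 0 < √(t ^ 2 + b ^ 2) := sqrt_pos.2 (by positivity)
    simp only [smul_eq_mul]
    rw [e1, e2, abs_of_pos (by positivity)]
    field_simp
  linarith

lemma integral_Ioi_inv_sq_add_sq {c : ℝ} (hc : 0 < c) :
    ∫ t in Ioi (0 : ℝ), 1 / (t ^ 2 + c ^ 2) = π / (2 * c) := by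
  have h := integral_comp_mul_left_Ioi (fun t : ℝ => (1 + t ^ 2)⁻¹) 0 (inv_pos.2 hc)
  rw [mul_zero, integral_Ioi_inv_one_add_sq] at h
  have : ∀ t : ℝ, 1 / (t ^ 2 + c ^ 2) = (c ^ 2)⁻¹ * (1 + (c⁻¹ * t) ^ 2)⁻¹ := by
    intro t
    have : t ^ 2 + c ^ 2 ≠ 0 := by positivity
    field_simp
    ring
  simp_rw [this]
  rw [integral_const_mul, h]
  simp
  field_simp

lemma integrable_inv_sq_add_sq {c : ℝ} (hc : 0 < c) :
    Integrable fun t : ℝ => 1 / (t ^ 2 + c ^ 2) := by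
  have h := (integrable_inv_one_add_sq.comp_mul_left' (inv_pos.2 hc).ne').const_mul (c ^ 2)⁻¹
  refine h.congr (Eventually.of_forall fun t => ?_)
  have : t ^ 2 + c ^ 2 ≠ 0 := by positivity
  simp only
  field_simp
  ring

lemma agmIntegral_bounds {a b : ℝ} (hb : 0 < b) (hab : b ≤ a) :
    π / (2 * a) ≤ agmIntegral a b ∧ agmIntegral a b ≤ π / (2 * b) := by
  have ha : 0 < a := hb.trans_le hab
  have e : ∀ c t : ℝ, 1 / (t ^ 2 + c ^ 2) = 1 / (√(t ^ 2 + c ^ 2) * √(t ^ 2 + c ^ 2)) :=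
    fun c t => by rw [mul_self_sqrt (by positivity)]
  have hmono : ∀ t : ℝ, √(t ^ 2 + b ^ 2) ≤ √(t ^ 2 + a ^ 2) := fun t =>
    sqrt_le_sqrt (by gcongr)
  have hpos : ∀ c t : ℝ, 0 < c → 0 < √(t ^ 2 + c ^ 2) := fun c t hc => sqrt_pos.2 (by positivity)
  have hle1 : ∀ t : ℝ, 1 / (√(t ^ 2 + a ^ 2) * √(t ^ 2 + b ^ 2)) ≤ 1 / (t ^ 2 + b ^ 2) := fun t => by
    rw [e b]
    have := hpos b t hb
    have := hmono t
    gcongr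
  have hle2 : ∀ t : ℝ, 1 / (t ^ 2 + a ^ 2) ≤ 1 / (√(t ^ 2 + a ^ 2) * √(t ^ 2 + b ^ 2)) := fun t => by
    rw [e a]
    have := hpos b t hb
    have := hpos a t ha
    have := hmono t
    gcongr
  have hint : Integrable fun t : ℝ => 1 / (√(t ^ 2 + a ^ 2) * √(t ^ 2 + b ^ 2)) := by
    refine (integrable_inv_sq_add_sq hb).mono' (by measurability) (Eventually.of_forall fun t => ?_)
    rw [norm_of_nonneg (by positivity)]
    exact hle1 t
  rw [← integral_Ioi_inv_sq_add_sq ha, ← integral_Ioi_inv_sq_add_sq hb]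
  exact ⟨integral_mono (integrable_inv_sq_add_sq ha).integrableOn hint.integrableOn hle2,
    integral_mono hint.integrableOn (integrable_inv_sq_add_sq hb).integrableOn hle1⟩

lemma integral_Ioo_rpow_mul_rpow {α β : ℝ} (hα : 0 < α) (hβ : 0 < β) :
    ∫ x in Ioo (0 : ℝ) 1, x ^ (α - 1) * (1 - x) ^ (β - 1) =
      Real.Gamma α * Real.Gamma β / Real.Gamma (α + β) := by
  have h := ProbabilityTheory.beta_eq_betaIntegralReal α β hα hβ
  rw [ProbabilityTheory.beta] at h
  rw [h, Complex.betaIntegral, intervalIntegral.integral_of_le zero_le_one,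
    ← integral_Ioc_eq_integral_Ioo]
  have : ∫ x in Ioc (0 : ℝ) 1, (x : ℂ) ^ ((α : ℂ) - 1) * (1 - (x : ℂ)) ^ ((β : ℂ) - 1) =
      ∫ x in Ioc (0 : ℝ) 1, ((x ^ (α - 1) * (1 - x) ^ (β - 1) : ℝ) : ℂ) := by
    refine setIntegral_congr_fun measurableSet_Ioc fun x hx => ?_
    rw [Complex.ofReal_mul, Complex.ofReal_cpow hx.1.le, Complex.ofReal_cpow (by linarith [hx.2])]
    push_cast
    rfl
  rw [this, integral_complex_ofReal, Complex.ofReal_re]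

lemma agmIntegral_sqrt_two_one :
    agmIntegral √2 1 = Real.Gamma (1 / 4) ^ 2 / (4 * √2 * √π) := by
  have key := integral_image_eq_integral_abs_deriv_smul (s := Ioi (0 : ℝ))
    (f := fun t => ((1 + t ^ 2) ^ 2)⁻¹) (f' := fun t => -(4 * t / (1 + t ^ 2) ^ 3)) measurableSet_Ioi
    (fun t ht => by
      have h1 : 1 + t ^ 2 ≠ 0 := by positivity
      have := ((((hasDerivAt_id t).pow 2).const_add 1).pow 2).inv (pow_ne_zero 2 h1)
      refine (this.congr_deriv ?_).hasDerivWithinAt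
      simp
      field_simp
      ring)
    (fun x hx y hy hxy => by
      have hx : 0 < x := hx
      have hy : 0 < y := hy
      have h1 := inv_injective hxy
      have h2 := (pow_left_inj₀ (by positivity) (by positivity) two_ne_zero).1 h1
      exact (pow_left_inj₀ hx.le hy.le two_ne_zero).1 (by linarith))
    (fun v => v ^ ((1 / 4 : ℝ) - 1) * (1 - v) ^ ((1 / 2 : ℝ) - 1))
  have himg : (fun t : ℝ => ((1 + t ^ 2) ^ 2)⁻¹) '' Ioi (0 : ℝ) = Ioo 0 1 := by
    ext v
    constructor
    · rintro ⟨t, ht, rfl⟩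
      have ht : 0 < t := ht
      refine ⟨by positivity, inv_lt_one_of_one_lt₀ ?_⟩
      exact one_lt_pow₀ (by nlinarith) two_ne_zero
    · rintro ⟨h0, h1⟩
      have h2 : 1 < √(v⁻¹) := by
        rw [lt_sqrt zero_le_one, one_pow]
        exact (one_lt_inv₀ h0).2 h1
      refine ⟨√(√(v⁻¹) - 1), sqrt_pos.2 (by linarith), ?_⟩
      simp only
      rw [sq_sqrt (by linarith), add_sub_cancel, sq_sqrt (by positivity), inv_inv]
  rw [himg, integral_Ioo_rpow_mul_rpow (by norm_num) (by norm_num)] at key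
  have hR : ∫ t in Ioi (0 : ℝ), |-(4 * t / (1 + t ^ 2) ^ 3)| •
      ((((1 + t ^ 2) ^ 2)⁻¹) ^ ((1 / 4 : ℝ) - 1) * (1 - ((1 + t ^ 2) ^ 2)⁻¹) ^ ((1 / 2 : ℝ) - 1)) =
      4 * agmIntegral √2 1 := by
    rw [agmIntegral, ← integral_const_mul]
    refine setIntegral_congr_fun measurableSet_Ioi fun t ht => ?_
    have ht : 0 < t := ht
    have hw : 0 < 1 + t ^ 2 := by positivity
    have e1 : (((1 + t ^ 2) ^ 2)⁻¹ : ℝ) ^ ((1 / 4 : ℝ) - 1) = (1 + t ^ 2) * √(1 + t ^ 2) := by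
      rw [inv_rpow (by positivity), ← rpow_neg (by positivity), ← rpow_natCast, ← rpow_mul hw.le,
        sqrt_eq_rpow]
      nth_rewrite 2 [← rpow_one (1 + t ^ 2)]
      rw [← rpow_add hw]
      norm_num
    have e2 : (1 - ((1 + t ^ 2) ^ 2)⁻¹ : ℝ) ^ ((1 / 2 : ℝ) - 1) =
        (1 + t ^ 2) / (t * √(t ^ 2 + 2)) := by
      have : (1 - ((1 + t ^ 2) ^ 2)⁻¹ : ℝ) = (t * √(t ^ 2 + 2) / (1 + t ^ 2)) ^ 2 := by
        rw [div_pow, mul_pow, sq_sqrt (by positivity)]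
        field_simp
        ring
      rw [this, ← rpow_natCast, ← rpow_mul (by positivity)]
      norm_num
      rw [rpow_neg_one, inv_div]
    have h4 : √(1 + t ^ 2) ^ 2 = 1 + t ^ 2 := sq_sqrt hw.le
    have h5 : 0 < √(1 + t ^ 2) := sqrt_pos.2 hw
    have h6 : 0 < √(t ^ 2 + 2) := sqrt_pos.2 (by positivity)
    simp only [smul_eq_mul]
    rw [e1, e2, abs_neg, abs_of_pos (by positivity), sq_sqrt zero_le_two, one_pow, add_comm (t ^ 2) 1]
    field_simp
    rw [h4]
  rw [hR] at key
  have hrefl := Real.Gamma_mul_Gamma_one_sub (1 / 4)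
  rw [show π * (1 / 4) = π / 4 by ring, sin_pi_div_four] at hrefl
  norm_num at hrefl key
  rw [Real.Gamma_one_half_eq] at key
  have hg : 0 < Real.Gamma (3 / 4) := Real.Gamma_pos_of_pos (by norm_num)
  have hg' : 0 < Real.Gamma (1 / 4) := Real.Gamma_pos_of_pos (by norm_num)
  have h2 : √2 * √2 = 2 := mul_self_sqrt zero_le_two
  have hpi : √π * √π = π := mul_self_sqrt pi_pos.le
  have hp : 0 < √π := sqrt_pos.2 pi_pos
  have hs2 : 0 < √2 := sqrt_pos.2 zero_lt_two
  have h34 : Real.Gamma (3 / 4) = √2 * π / Real.Gamma (1 / 4) := by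
    rw [eq_div_iff hg'.ne', mul_comm, hrefl]
    field_simp
    linear_combination -h2
  rw [h34] at key
  have e : Real.Gamma (1 / 4) * √π / (√2 * π / Real.Gamma (1 / 4)) =
      Real.Gamma (1 / 4) ^ 2 / (√2 * √π) := by
    nth_rewrite 2 [← hpi]
    field_simp
  rw [e] at key
  rw [← mul_right_inj' (four_ne_zero (α := ℝ)), ← key]
  field_simp

lemma agmIntegral_mul {c : ℝ} (hc : 0 < c) (a b : ℝ) :
    agmIntegral (c * a) (c * b) = agmIntegral a b / c := by
  have h := integral_comp_mul_left_Ioi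
    (fun t : ℝ => 1 / (√(t ^ 2 + (c * a) ^ 2) * √(t ^ 2 + (c * b) ^ 2))) 0 hc
  have e : ∀ d t : ℝ, √((c * t) ^ 2 + (c * d) ^ 2) = c * √(t ^ 2 + d ^ 2) := fun d t => by
    rw [mul_pow, mul_pow, ← mul_add, sqrt_mul (sq_nonneg c), sqrt_sq hc.le]
  have e2 : ∀ t : ℝ, 1 / (c * √(t ^ 2 + a ^ 2) * (c * √(t ^ 2 + b ^ 2))) =
      (c ^ 2)⁻¹ * (1 / (√(t ^ 2 + a ^ 2) * √(t ^ 2 + b ^ 2))) := fun t => by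
    rw [one_div, one_div, ← mul_inv]
    congr 1
    ring
  simp only [e, e2] at h
  rw [integral_const_mul, mul_zero, smul_eq_mul] at h
  rw [agmIntegral, agmIntegral]
  field_simp at h ⊢
  linarith

end AGM

section Weber

open Filter Topology

/-- The infinite product `(-q; q²)_∞`. -/
noncomputable def oddProd (q : ℝ) : ℝ := ∏' k : ℕ, (1 + q ^ (2 * k + 1))

lemma multipliable_oddProd {q : ℝ} (hq : |q| < 1) :
    Multipliable fun k : ℕ => 1 + q ^ (2 * k + 1) :=
  multipliable_one_add_of_summable (summable_norm_pow_mul_add hq 2 1 two_ne_zero)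

lemma oddProd_pos {q : ℝ} (hq : |q| < 1) : 0 < oddProd q := by
  have hpos : ∀ k : ℕ, 0 < 1 + q ^ (2 * k + 1) := fun k => by
    have : |q ^ (2 * k + 1)| < 1 := by
      rw [abs_pow]; exact pow_lt_one₀ (abs_nonneg q) hq (by omega)
    linarith [(abs_lt.1 this).1]
  refine lt_of_le_of_ne (ge_of_tendsto' (multipliable_oddProd hq).hasProd.tendsto_prod_nat
    fun n => Finset.prod_nonneg fun k _ => (hpos k).le) (Ne.symm ?_)
  exact tprod_one_add_ne_zero_of_summable (f := fun k : ℕ => q ^ (2 * k + 1))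
    (fun k => (hpos k).ne') (summable_norm_pow_mul_add hq 2 1 two_ne_zero)

lemma oddProd_mul_oddProd_neg {q : ℝ} (hq : |q| < 1) :
    oddProd q * oddProd (-q) = oddProd (-q ^ 2) := by
  rw [oddProd, oddProd, oddProd,
    ← (multipliable_oddProd hq).tprod_mul (multipliable_oddProd (by rwa [abs_neg]))]
  refine tprod_congr fun k => ?_
  have ho : Odd (2 * k + 1) := odd_two_mul_add_one k
  rw [ho.neg_pow, ho.neg_pow, ← pow_mul]
  ring

lemma theta_pos {q : ℝ} (hq0 : q ≠ 0) (hq : |q| < 1) : 0 < theta q := by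
  rw [theta_eq_prod hq0 hq]
  exact mul_pos (eulerProd_pos (sq_nonneg q) ((sq_lt_one_iff_abs_lt_one q).2 hq))
    (pow_pos (oddProd_pos hq) 2)

lemma theta_mul_oddProd_neg_sq {q : ℝ} (hq0 : q ≠ 0) (hq : |q| < 1) :
    theta q * oddProd (-q) ^ 2 = theta (-q) * oddProd q ^ 2 := by
  rw [theta_eq_prod hq0 hq, theta_eq_prod (neg_ne_zero.2 hq0) (by rwa [abs_neg]), neg_sq,
    oddProd, oddProd]
  ring

lemma theta_neg_lt_theta {q : ℝ} (h0 : 0 < q) (h1 : q < 1) : theta (-q) < theta q := by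
  have hq : |q| < 1 := by rwa [abs_of_pos h0]
  refine Summable.tsum_lt_tsum (i := 1) (fun n => ?_) ?_
    (summable_norm_theta (by rwa [abs_neg])).of_norm (summable_norm_theta hq).of_norm
  · rw [neg_pow_natAbs_sq]
    have : 0 ≤ q ^ n.natAbs ^ 2 := by positivity
    split_ifs <;> linarith
  · simp
    linarith

lemma tendsto_pow_two_pow {q : ℝ} (h0 : 0 < q) (h1 : q < 1) :
    Tendsto (fun n : ℕ => q ^ 2 ^ n) atTop (𝓝[>] 0) := by
  refine tendsto_nhdsWithin_iff.2 ⟨?_, Eventually.of_forall fun n => pow_pos h0 _⟩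
  exact (tendsto_pow_atTop_nhds_zero_of_lt_one h0.le h1).comp
    (tendsto_pow_atTop_atTop_of_one_lt one_lt_two)

lemma apply_pow_two_pow {F : ℝ → ℝ} {c : ℝ}
    (hF : ∀ q, 0 < q → q < 1 → F (q ^ 2) = c * F q) {q : ℝ} (h0 : 0 < q) (h1 : q < 1) (n : ℕ) :
    F (q ^ 2 ^ n) = c ^ n * F q := by
  induction n with
  | zero => simp
  | succ n ih =>
    rw [pow_succ 2, pow_mul, hF _ (pow_pos h0 _) (pow_lt_one₀ h0.le h1 (by positivity)), ih]
    ring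

/-- A function invariant under `q ↦ q ^ 2` with a limit at `0⁺` equals that limit. -/
lemma eq_of_apply_sq_eq {F : ℝ → ℝ} {l : ℝ} (hF : ∀ q, 0 < q → q < 1 → F (q ^ 2) = F q)
    (hl : Tendsto F (𝓝[>] 0) (𝓝 l)) {q : ℝ} (h0 : 0 < q) (h1 : q < 1) : F q = l := by
  refine tendsto_nhds_unique ?_ (hl.comp (tendsto_pow_two_pow h0 h1))
  refine tendsto_const_nhds.congr fun n => ?_
  have := apply_pow_two_pow (c := 1) (F := F) (fun q h0 h1 => by rw [hF q h0 h1, one_mul]) h0 h1 n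
  rw [Function.comp_apply, this, one_pow, one_mul]

lemma eq_one_of_apply_sq_eq_sq {F : ℝ → ℝ} (hpos : ∀ q, 0 < q → q < 1 → 0 < F q)
    (hF : ∀ q, 0 < q → q < 1 → F (q ^ 2) = F q ^ 2)
    (hl : Tendsto F (𝓝[>] 0) (𝓝 1)) {q : ℝ} (h0 : 0 < q) (h1 : q < 1) : F q = 1 := by
  have hlog : Tendsto (fun q => log (F q)) (𝓝[>] 0) (𝓝 0) := by
    simpa using hl.log one_ne_zero
  have h2 := (hlog.comp (tendsto_pow_two_pow h0 h1)).mul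
    (tendsto_pow_atTop_nhds_zero_of_lt_one (r := (1 / 2 : ℝ)) (by norm_num) (by norm_num))
  have h3 : Tendsto (fun _ : ℕ => log (F q)) atTop (𝓝 (0 * 0)) := by
    refine h2.congr fun n => ?_
    have := apply_pow_two_pow (c := 2) (F := fun q => log (F q)) (fun q h0 h1 => by
      rw [hF q h0 h1, log_pow]; norm_num) h0 h1 n
    rw [Function.comp_apply, this, mul_right_comm, ← mul_pow]
    norm_num
  have h4 : log (F q) = 0 := by simpa using tendsto_nhds_unique tendsto_const_nhds h3
  rw [← exp_log (hpos q h0 h1), h4, exp_zero]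

lemma tendsto_theta_zero : Tendsto theta (𝓝[>] 0) (𝓝 1) := by
  have := hasDerivAt_theta_zero.continuousAt.tendsto
  rw [theta_zero] at this
  exact this.mono_left nhdsWithin_le_nhds

lemma hasDerivAt_theta_neg {q : ℝ} {d : ℝ} (hd : HasDerivAt theta d (-q)) :
    HasDerivAt (fun x => theta (-x)) (-d) q := by
  exact (hd.comp q (hasDerivAt_neg q)).congr_deriv (by ring)

lemma tendsto_theta_neg_zero : Tendsto (fun q => theta (-q)) (𝓝[>] 0) (𝓝 1) := by
  have := (hasDerivAt_theta_neg (q := 0) (by simpa using hasDerivAt_theta_zero)).continuousAt.tendsto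
  rw [neg_zero, theta_zero] at this
  exact this.mono_left nhdsWithin_le_nhds

lemma hasDerivAt_theta {q : ℝ} (hq : |q| < 1) : HasDerivAt theta (deriv theta q) q :=
  ((contDiffAt_theta hq 1).differentiableAt one_ne_zero).hasDerivAt

lemma agmIntegral_theta {q : ℝ} (h0 : 0 < q) (h1 : q < 1) :
    agmIntegral (theta q ^ 2) (theta (-q) ^ 2) = π / 2 := by
  refine eq_of_apply_sq_eq (F := fun q => agmIntegral (theta q ^ 2) (theta (-q) ^ 2))
    (fun q h0 h1 => ?_) ?_ h0 h1
  · have hq : |q| < 1 := by rwa [abs_of_pos h0]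
    have hq' : |-q| < 1 := by rwa [abs_neg]
    have ha := theta_pos h0.ne' hq
    have hb := theta_pos (neg_ne_zero.2 h0.ne') hq'
    have e1 : theta (q ^ 2) ^ 2 = (theta q ^ 2 + theta (-q) ^ 2) / 2 := by
      rw [theta_sq_add_theta_neg_sq hq]; ring
    have e2 : theta (-q ^ 2) ^ 2 = √(theta q ^ 2 * theta (-q) ^ 2) := by
      rw [← mul_pow, sqrt_sq (mul_pos ha hb).le, theta_mul_theta_neg hq]
    rw [e1, e2, agmIntegral_landen (pow_pos ha 2) (pow_pos hb 2)]
  · have hbd : ∀ᶠ q in 𝓝[>] (0 : ℝ), π / (2 * theta q ^ 2) ≤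
        agmIntegral (theta q ^ 2) (theta (-q) ^ 2) ∧
        agmIntegral (theta q ^ 2) (theta (-q) ^ 2) ≤ π / (2 * theta (-q) ^ 2) := by
      filter_upwards [Ioo_mem_nhdsGT (zero_lt_one' ℝ)] with q hq
      have hq' : |-q| < 1 := by rw [abs_neg, abs_of_pos hq.1]; exact hq.2
      have hb := theta_pos (neg_ne_zero.2 hq.1.ne') hq'
      exact agmIntegral_bounds (pow_pos hb 2)
        (pow_le_pow_left₀ hb.le (theta_neg_lt_theta hq.1 hq.2).le 2)
    have l1 : Tendsto (fun q => π / (2 * theta q ^ 2)) (𝓝[>] 0) (𝓝 (π / 2)) := by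
      have := (tendsto_const_nhds (x := π)).div ((tendsto_theta_zero.pow 2).const_mul 2)
        (by norm_num)
      rwa [one_pow, mul_one] at this
    have l2 : Tendsto (fun q => π / (2 * theta (-q) ^ 2)) (𝓝[>] 0) (𝓝 (π / 2)) := by
      have := (tendsto_const_nhds (x := π)).div ((tendsto_theta_neg_zero.pow 2).const_mul 2)
        (by norm_num)
      rwa [one_pow, mul_one] at this
    exact tendsto_of_tendsto_of_tendsto_of_le_of_le' l1 l2 (hbd.mono fun _ h => h.1)
      (hbd.mono fun _ h => h.2)

lemma tendsto_theta_pow_sub_div :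
    Tendsto (fun q => (theta q ^ 4 - theta (-q) ^ 4) / q) (𝓝[>] 0) (𝓝 16) := by
  have h1 := (hasDerivAt_theta_zero.pow 4).sub
    ((hasDerivAt_theta_neg (q := 0) (by simpa using hasDerivAt_theta_zero)).pow 4)
  have h2 := h1.tendsto_slope_zero_right
  simp only [Pi.sub_apply, Pi.pow_apply, neg_zero, theta_zero, zero_add, smul_eq_mul] at h2
  norm_num at h2
  exact h2.congr fun q => by rw [div_eq_inv_mul]

lemma tendsto_deriv_theta_zero :
    Tendsto (deriv theta) (𝓝 0) (𝓝 2) := by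
  have hc := (contDiffAt_theta (q := 0) (by simp) 1).continuousAt_fderiv (by norm_num)
  have := (hc.clm_apply (continuousAt_const (y := (1 : ℝ)))).tendsto
  simpa only [fderiv_apply_one_eq_deriv, hasDerivAt_theta_zero.deriv] using this

lemma theta_pow_four_sub_pos {q : ℝ} (h0 : 0 < q) (h1 : q < 1) :
    0 < theta q ^ 4 - theta (-q) ^ 4 := by
  have hq' : |-q| < 1 := by rwa [abs_neg, abs_of_pos h0]
  have hb := theta_pos (neg_ne_zero.2 h0.ne') hq'
  exact sub_pos.2 (pow_lt_pow_left₀ (theta_neg_lt_theta h0 h1) hb.le four_ne_zero)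

/-- The logarithmic derivative of `θ₃ / θ₄`. -/
lemma logDeriv_theta_add {q : ℝ} (h0 : 0 < q) (h1 : q < 1) :
    deriv theta q / theta q + deriv theta (-q) / theta (-q) =
      (theta q ^ 4 - theta (-q) ^ 4) / (4 * q) := by
  have key := eq_of_apply_sq_eq (l := 1 / 4) (F := fun q => q *
    (deriv theta q / theta q + deriv theta (-q) / theta (-q)) / (theta q ^ 4 - theta (-q) ^ 4))
    (fun q h0 h1 => by
      have hq : |q| < 1 := by rwa [abs_of_pos h0]
      have hq' : |-q| < 1 := by rwa [abs_neg]
      have hq2 := abs_sq_lt_one hq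
      have hq2' : |-q ^ 2| < 1 := by rwa [abs_neg]
      have ha := theta_pos h0.ne' hq
      have hb := theta_pos (neg_ne_zero.2 h0.ne') hq'
      have hα := theta_pos (pow_ne_zero 2 h0.ne') hq2
      have hβ := theta_pos (neg_ne_zero.2 (pow_ne_zero 2 h0.ne')) hq2'
      have p1 := theta_pow_four_sub_pos h0 h1
      have p2 := theta_pow_four_sub_pos (pow_pos h0 2) (pow_lt_one₀ h0.le h1 two_ne_zero)
      have hnhds : ∀ᶠ x in 𝓝 q, |x| < 1 :=
        (continuous_abs.tendsto q).eventually (gt_mem_nhds hq)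
      have i1 := theta_sq_add_theta_neg_sq hq
      have i2 := theta_mul_theta_neg hq
      have da := hasDerivAt_theta hq
      have db := hasDerivAt_theta_neg (hasDerivAt_theta hq')
      have dα := HasDerivAt.comp (h₂ := theta) (h := fun x : ℝ => x ^ 2) q
        (hasDerivAt_theta hq2) (hasDerivAt_pow 2 q)
      have dβ := HasDerivAt.comp (h₂ := fun x => theta (-x)) (h := fun x : ℝ => x ^ 2) q
        (hasDerivAt_theta_neg (hasDerivAt_theta hq2')) (hasDerivAt_pow 2 q)
      have d1 := ((da.pow 2).add (db.pow 2)).unique (((dα.pow 2).const_mul 2).congr_of_eventuallyEq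
        (hnhds.mono fun x hx => theta_sq_add_theta_neg_sq hx))
      have d2 := (da.mul db).unique ((dβ.pow 2).congr_of_eventuallyEq
        (hnhds.mono fun x hx => theta_mul_theta_neg hx))
      simp only [Function.comp_apply] at d1 d2
      norm_num at d1 d2
      set a := theta q
      set b := theta (-q)
      set α := theta (q ^ 2)
      set β := theta (-q ^ 2)
      have e1 : deriv theta (q ^ 2) / α = (a * deriv theta q - b * deriv theta (-q)) /
          (2 * q * (a ^ 2 + b ^ 2)) := by
        rw [i1, div_eq_div_iff (by positivity) (by positivity)]
        linear_combination (-α / 2) * d1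
      have e2 : deriv theta (-q ^ 2) / β = -(deriv theta q * b - a * deriv theta (-q)) /
          (4 * q * (a * b)) := by
        rw [i2, div_eq_div_iff (by positivity) (by positivity)]
        linear_combination β * d2
      have e3 : α ^ 4 - β ^ 4 = (a ^ 2 - b ^ 2) ^ 2 / 4 := by
        have : α ^ 2 = (a ^ 2 + b ^ 2) / 2 := by linarith
        linear_combination (α ^ 2 + (a ^ 2 + b ^ 2) / 2) * this + (a * b + β ^ 2) * i2
      rw [e1, e2, div_eq_div_iff p2.ne' p1.ne', e3]
      field_simp
      ring) (by
      have t0 := tendsto_deriv_theta_zero.mono_left (nhdsWithin_le_nhds (s := Set.Ioi 0))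
      have t1 : Tendsto (fun q : ℝ => deriv theta (-q)) (𝓝[>] 0) (𝓝 2) := by
        have hn : Tendsto (fun q : ℝ => -q) (𝓝[>] 0) (𝓝 0) := by
          simpa using (continuous_neg.tendsto (0 : ℝ)).mono_left nhdsWithin_le_nhds
        exact tendsto_deriv_theta_zero.comp hn
      have t2 := ((t0.div tendsto_theta_zero one_ne_zero).add
        (t1.div tendsto_theta_neg_zero one_ne_zero)).div tendsto_theta_pow_sub_div (by norm_num)
      norm_num at t2
      norm_num
      refine t2.congr' ?_
      filter_upwards [Ioo_mem_nhdsGT (zero_lt_one' ℝ)] with q hq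
      have hq0 := hq.1
      have := theta_pow_four_sub_pos hq.1 hq.2
      simp only [Pi.div_apply]
      field_simp) h0 h1
  have := theta_pow_four_sub_pos h0 h1
  rw [div_eq_iff this.ne'] at key
  rw [eq_div_iff (by positivity)]
  linear_combination 4 * key

lemma one_sub_sum_le_qPoch {Q : ℝ} (h0 : 0 ≤ Q) (h1 : Q < 1) (n : ℕ) :
    1 - ∑ i ∈ Finset.range n, Q ^ (i + 1) ≤ qPoch Q n := by
  induction n with
  | zero => simp [qPoch]
  | succ n ih =>
    rw [Finset.sum_range_succ, qPoch_succ]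
    have := mul_le_mul_of_nonneg_left (qPoch_le_one h0 h1 n) (pow_nonneg h0 (n + 1))
    linarith

lemma tendsto_eulerProd : Tendsto eulerProd (𝓝[>] 0) (𝓝 1) := by
  have hlow : Tendsto (fun Q : ℝ => 1 - Q * (1 - Q)⁻¹) (𝓝[>] 0) (𝓝 1) := by
    have : ContinuousAt (fun Q : ℝ => 1 - Q * (1 - Q)⁻¹) 0 := by
      refine continuousAt_const.sub (continuousAt_id.mul
        ((continuousAt_const.sub continuousAt_id).inv₀ (by simp)))
    simpa using this.tendsto.mono_left nhdsWithin_le_nhds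
  refine tendsto_of_tendsto_of_tendsto_of_le_of_le' hlow tendsto_const_nhds ?_ ?_
  · filter_upwards [Ioo_mem_nhdsGT (zero_lt_one' ℝ)] with Q hQ
    refine ge_of_tendsto' (qPoch_tendsto hQ.1.le hQ.2) fun n => ?_
    refine le_trans ?_ (one_sub_sum_le_qPoch hQ.1.le hQ.2 n)
    have hs := (summable_geometric_of_lt_one hQ.1.le hQ.2).sum_le_tsum (Finset.range n)
      fun i _ => pow_nonneg hQ.1.le i
    rw [tsum_geometric_of_lt_one hQ.1.le hQ.2] at hs
    simp only [pow_succ', ← Finset.mul_sum]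
    linarith [mul_le_mul_of_nonneg_left hs hQ.1.le]
  · filter_upwards [Ioo_mem_nhdsGT (zero_lt_one' ℝ)] with Q hQ
    simpa [qPoch] using eulerProd_le_qPoch hQ.1.le hQ.2 0

lemma tendsto_oddProd_neg_sq : Tendsto (fun q => oddProd (-q) ^ 2) (𝓝[>] 0) (𝓝 1) := by
  have hsq : Tendsto (fun q : ℝ => q ^ 2) (𝓝[>] 0) (𝓝[>] 0) := by
    refine tendsto_nhdsWithin_iff.2 ⟨?_, ?_⟩
    · simpa using ((continuous_pow 2).tendsto (0 : ℝ)).mono_left nhdsWithin_le_nhds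
    · filter_upwards [self_mem_nhdsWithin] with q hq using pow_pos (Set.mem_Ioi.1 hq) 2
  have := tendsto_theta_neg_zero.div (tendsto_eulerProd.comp hsq) one_ne_zero
  rw [div_one] at this
  refine this.congr' ?_
  filter_upwards [Ioo_mem_nhdsGT (zero_lt_one' ℝ)] with q hq
  have hq' : |-q| < 1 := by rw [abs_neg, abs_of_pos hq.1]; exact hq.2
  have hE := eulerProd_pos (sq_nonneg q) (pow_lt_one₀ hq.1.le hq.2 two_ne_zero)
  simp only [Pi.div_apply, Function.comp_apply]
  rw [theta_eq_prod (neg_ne_zero.2 hq.1.ne') hq', neg_sq, ← oddProd,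
    mul_div_cancel_left₀ _ hE.ne']

lemma h_eq_oddProd {Q : ℝ} (h0 : 0 < Q) (h1 : Q < 1) :
    h Q = Q ^ (-(1 : ℝ) / 24) * oddProd (-Q) := by
  have hQ : |-Q| < 1 := by rwa [abs_neg, abs_of_pos h0]
  have hm (b : ℕ) : Multipliable fun n : ℕ => 1 + (-Q) ^ (4 * n + b) :=
    multipliable_one_add_of_summable (summable_norm_pow_mul_add hQ 4 b four_ne_zero)
  have he : ∀ n : ℕ, 1 + (-Q) ^ (2 * (2 * n) + 1) = 1 + (-Q) ^ (4 * n + 1) := fun n => by ring_nf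
  have ho : ∀ n : ℕ, 1 + (-Q) ^ (2 * (2 * n + 1) + 1) = 1 + (-Q) ^ (4 * n + 3) :=
    fun n => by ring_nf
  rw [h, oddProd, ← tprod_even_mul_odd (f := fun k : ℕ => 1 + (-Q) ^ (2 * k + 1))
    (by simpa only [he] using hm 1) (by simpa only [ho] using hm 3)]
  simp only [he, ho]
  rw [← (hm 1).tprod_mul (hm 3)]
  congr 1
  refine tprod_congr fun n => ?_
  rw [Odd.neg_pow ⟨2 * n, by ring⟩, Odd.neg_pow ⟨2 * n + 1, by ring⟩, sub_eq_add_neg,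
    sub_eq_add_neg]

lemma h_pos {Q : ℝ} (h0 : 0 < Q) (h1 : Q < 1) : 0 < h Q := by
  rw [h_eq_oddProd h0 h1]
  exact mul_pos (rpow_pos_of_pos h0 _) (oddProd_pos (by rwa [abs_neg, abs_of_pos h0]))

lemma oddProd_neg_pow_mul {q : ℝ} (h0 : 0 < q) (h1 : q < 1) :
    oddProd (-q) ^ 24 * ((theta q ^ 4 - theta (-q) ^ 4) * theta q ^ 4) =
      16 * q * theta (-q) ^ 8 := by
  have key := eq_one_of_apply_sq_eq_sq (F := fun q => (oddProd (-q) ^ 2) ^ 12 *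
      ((theta q ^ 4 - theta (-q) ^ 4) / q) * theta q ^ 4 / (16 * theta (-q) ^ 8))
    (fun q h0 h1 => by
      have hq : |q| < 1 := by rwa [abs_of_pos h0]
      have hq' : |-q| < 1 := by rwa [abs_neg]
      have ha := theta_pos h0.ne' hq
      have hb := theta_pos (neg_ne_zero.2 h0.ne') hq'
      have hf := oddProd_pos hq'
      have := theta_pow_four_sub_pos h0 h1
      positivity)
    (fun q h0 h1 => by
      have hq : |q| < 1 := by rwa [abs_of_pos h0]
      have hq' : |-q| < 1 := by rwa [abs_neg]
      have ha := theta_pos h0.ne' hq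
      have hb := theta_pos (neg_ne_zero.2 h0.ne') hq'
      have i1 := theta_sq_add_theta_neg_sq hq
      have i2 := theta_mul_theta_neg hq
      have i3 := theta_mul_oddProd_neg_sq h0.ne' hq
      simp only [← oddProd_mul_oddProd_neg hq]
      have hα : theta (q ^ 2) ^ 4 = ((theta q ^ 2 + theta (-q) ^ 2) / 2) ^ 2 := by
        rw [i1]; ring
      have hβ : theta (-q ^ 2) ^ 4 = (theta q * theta (-q)) ^ 2 := by
        rw [i2]; ring
      have hβ' : theta (-q ^ 2) ^ 8 = (theta q * theta (-q)) ^ 4 := by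
        rw [i2]; ring
      rw [hα, hβ, hβ']
      have i4 : oddProd q ^ 2 = theta q * oddProd (-q) ^ 2 / theta (-q) := by
        rw [i3]; field_simp
      rw [mul_pow, i4]
      field_simp
      ring) (by
      have := (((tendsto_oddProd_neg_sq.pow 12).mul tendsto_theta_pow_sub_div).mul
        (tendsto_theta_zero.pow 4)).div ((tendsto_theta_neg_zero.pow 8).const_mul 16)
        (by norm_num)
      norm_num at this
      exact this) h0 h1
  have hq' : |-q| < 1 := by rwa [abs_neg, abs_of_pos h0]
  have hb := theta_pos (neg_ne_zero.2 h0.ne') hq'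
  rw [div_eq_one_iff_eq (by positivity)] at key
  field_simp at key
  linear_combination key

lemma h_eq_rpow {q : ℝ} (h0 : 0 < q) (h1 : q < 1) :
    h q = (16 * theta (-q) ^ 8 / ((theta q ^ 4 - theta (-q) ^ 4) * theta q ^ 4)) ^
      ((1 : ℝ) / 24) := by
  have hq : |q| < 1 := by rwa [abs_of_pos h0]
  have ha := theta_pos h0.ne' hq
  have hd := theta_pow_four_sub_pos h0 h1
  have hp : h q ^ 24 =
      16 * theta (-q) ^ 8 / ((theta q ^ 4 - theta (-q) ^ 4) * theta q ^ 4) := by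
    have hr : (q ^ (-(1 : ℝ) / 24)) ^ 24 = q⁻¹ := by
      rw [← rpow_natCast, ← rpow_mul h0.le, ← rpow_neg_one]
      norm_num
    rw [h_eq_oddProd h0 h1, mul_pow, hr, eq_div_iff (by positivity), mul_assoc,
      oddProd_neg_pow_mul h0 h1]
    field_simp
  rw [← hp, ← rpow_natCast, ← rpow_mul (h_pos h0 h1).le]
  norm_num

lemma h_eventuallyEq {q : ℝ} (h0 : 0 < q) (h1 : q < 1) :
    h =ᶠ[𝓝 q] fun x => (16 * theta (-x) ^ 8 /
      ((theta x ^ 4 - theta (-x) ^ 4) * theta x ^ 4)) ^ ((1 : ℝ) / 24) := by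
  filter_upwards [Ioo_mem_nhds h0 h1] with x hx using h_eq_rpow hx.1 hx.2

lemma theta_exp_neg_pi_mul (a : ℝ) :
    theta (rexp (-π * a)) = ∑' n : ℤ, rexp (-π * a * (n : ℝ) ^ 2) := by
  refine tsum_congr fun n => ?_
  rw [← exp_nat_mul, Nat.cast_pow, Nat.cast_natAbs, Int.cast_abs, sq_abs, mul_comm]

lemma theta_exp_neg_pi_sq :
    theta (rexp (-π)) ^ 2 = √2 * theta (-rexp (-π)) ^ 2 := by
  have hp1 : rexp (-π / 2) < 1 := Real.exp_lt_one_iff.2 (by linarith [pi_pos])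
  have hq1 : rexp (-π) < 1 := Real.exp_lt_one_iff.2 (by linarith [pi_pos])
  have hp : |rexp (-π / 2)| < 1 := by rwa [abs_of_pos (exp_pos _)]
  have hq : |rexp (-π)| < 1 := by rwa [abs_of_pos (exp_pos _)]
  have hpq : rexp (-π / 2) ^ 2 = rexp (-π) := by rw [← exp_nat_mul]; push_cast; ring_nf
  have hF : theta (rexp (-π / 2)) ^ 2 = 2 * theta (rexp (-π) ^ 2) ^ 2 := by
    have := Real.tsum_exp_neg_mul_int_sq (a := 2) two_pos
    rw [← theta_exp_neg_pi_mul] at this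
    have e : ∑' n : ℤ, rexp (-π / 2 * (n : ℝ) ^ 2) = theta (rexp (-π / 2)) := by
      have := theta_exp_neg_pi_mul (1 / 2)
      simpa only [mul_one_div] using this.symm
    rw [e, ← sqrt_eq_rpow] at this
    have e2 : rexp (-π) ^ 2 = rexp (-π * 2) := by rw [← exp_nat_mul]; push_cast; ring_nf
    rw [e2, this, mul_pow, div_pow, sq_sqrt zero_le_two]
    ring
  have j1 := theta_sq_add_theta_neg_sq hp
  have j2 := theta_mul_theta_neg hp
  have j3 := theta_sq_add_theta_neg_sq hq
  rw [hpq] at j1 j2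
  have ha := theta_pos (exp_pos _).ne' hq
  have hb := theta_pos (neg_ne_zero.2 (exp_pos (-π)).ne') (by rwa [abs_neg])
  have h1 : theta (rexp (-π / 2)) ^ 2 = theta (rexp (-π)) ^ 2 + theta (-rexp (-π)) ^ 2 := by
    rw [hF, j3]
  have h2 : theta (-rexp (-π / 2)) ^ 2 = theta (rexp (-π)) ^ 2 - theta (-rexp (-π)) ^ 2 := by
    linarith
  have h3 : (theta (rexp (-π)) ^ 2) ^ 2 = (√2 * theta (-rexp (-π)) ^ 2) ^ 2 := by
    rw [mul_pow, sq_sqrt zero_le_two]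
    have : theta (rexp (-π / 2)) ^ 2 * theta (-rexp (-π / 2)) ^ 2 =
        (theta (-rexp (-π)) ^ 2) ^ 2 := by rw [← mul_pow, j2]
    rw [h1, h2] at this
    linarith
  exact (pow_left_inj₀ (by positivity) (by positivity) two_ne_zero).1 h3

lemma theta_neg_exp_neg_pi_pow_four :
    theta (-rexp (-π)) ^ 4 = Gamma (1 / 4) ^ 4 / (8 * π ^ 3) := by
  have hq1 : rexp (-π) < 1 := Real.exp_lt_one_iff.2 (by linarith [pi_pos])
  have hq : |-rexp (-π)| < 1 := by rwa [abs_neg, abs_of_pos (exp_pos _)]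
  have hb := theta_pos (neg_ne_zero.2 (exp_pos (-π)).ne') hq
  have := agmIntegral_theta (exp_pos (-π)) hq1
  rw [theta_exp_neg_pi_sq, mul_comm (√2)] at this
  nth_rewrite 2 [← mul_one (theta (-rexp (-π)) ^ 2)] at this
  rw [agmIntegral_mul (pow_pos hb 2), agmIntegral_sqrt_two_one] at this
  have hB : theta (-rexp (-π)) ^ 2 = Gamma (1 / 4) ^ 2 / (2 * √2 * √π * π) := by
    have h2 : 0 < √2 := by positivity
    have hπ : 0 < √π := sqrt_pos.2 pi_pos
    field_simp at this ⊢
    linarith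
  calc theta (-rexp (-π)) ^ 4 = (theta (-rexp (-π)) ^ 2) ^ 2 := by ring
    _ = Gamma (1 / 4) ^ 4 / (4 * √2 ^ 2 * √π ^ 2 * π ^ 2) := by rw [hB]; ring
    _ = _ := by rw [sq_sqrt zero_le_two, sq_sqrt pi_pos.le]; ring

end Weber

theorem h_hasDerivAt_exp_neg_pi :
    HasDerivAt h
      (-(Real.exp π * Real.Gamma (1 / 4) ^ 4) / (32 * 2 ^ ((7 : ℝ) / 8) * π ^ 3))
      (Real.exp (-π)) := by
  have h0 := exp_pos (-π)
  have h1 : rexp (-π) < 1 := Real.exp_lt_one_iff.2 (by linarith [pi_pos])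
  have hE : rexp π = (rexp (-π))⁻¹ := by rw [exp_neg, inv_inv]
  have h4 := theta_neg_exp_neg_pi_pow_four
  have hab : theta (rexp (-π)) ^ 4 = 2 * theta (-rexp (-π)) ^ 4 := by
    calc theta (rexp (-π)) ^ 4 = (theta (rexp (-π)) ^ 2) ^ 2 := by ring
      _ = √2 ^ 2 * theta (-rexp (-π)) ^ 4 := by rw [theta_exp_neg_pi_sq]; ring
      _ = _ := by rw [sq_sqrt zero_le_two]
  rw [hE]
  set q := rexp (-π)
  have hq : |q| < 1 := by rwa [abs_of_pos h0]
  have hq' : |-q| < 1 := by rwa [abs_neg]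
  have ha := theta_pos h0.ne' hq
  have hb := theta_pos (neg_ne_zero.2 h0.ne') hq'
  have hd := theta_pow_four_sub_pos h0 h1
  have hlog := logDeriv_theta_add h0 h1
  have da := hasDerivAt_theta hq
  have db := hasDerivAt_theta_neg (hasDerivAt_theta hq')
  have dR := ((db.pow 8).const_mul 16).div (((da.pow 4).sub (db.pow 4)).mul (da.pow 4))
    (mul_pos hd (pow_pos ha 4)).ne'
  have dH := dR.rpow_const (p := (1 : ℝ) / 24) (Or.inl
    (div_pos (mul_pos (by norm_num) (pow_pos hb 8)) (mul_pos hd (pow_pos ha 4))).ne')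
  have hR : 16 * theta (-q) ^ 8 / ((theta q ^ 4 - theta (-q) ^ 4) * theta q ^ 4) = 8 := by
    rw [hab]
    field_simp
    norm_num
  have hpow : (8 : ℝ) ^ ((1 : ℝ) / 24 - 1) = 1 / (4 * 2 ^ ((7 : ℝ) / 8)) := by
    rw [show (8 : ℝ) = 2 ^ (3 : ℝ) by norm_num, ← rpow_mul zero_le_two,
      show (3 : ℝ) * (1 / 24 - 1) = -(2 + 7 / 8) by norm_num, rpow_neg zero_le_two,
      rpow_add two_pos, one_div]
    norm_num
  refine HasDerivAt.congr_deriv (dH.congr_of_eventuallyEq (h_eventuallyEq h0 h1)) ?_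
  simp only [Pi.sub_apply, Pi.mul_apply, Pi.div_apply, Pi.pow_apply]
  rw [hR, hpow]
  set a := theta q
  set b := theta (-q)
  have hs : deriv theta q = a * (deriv theta q / a) := (mul_div_cancel₀ _ ha.ne').symm
  have ht : deriv theta (-q) = b * (deriv theta (-q) / b) := (mul_div_cancel₀ _ hb.ne').symm
  rw [hs, ht]
  generalize deriv theta q / a = s at hlog ⊢
  generalize deriv theta (-q) / b = t at hlog ⊢
  have hst : s = b ^ 4 / (4 * q) - t := by
    rw [eq_sub_of_add_eq hlog, hab]
    ring
  have hnum : (16 * (((8 : ℕ) : ℝ) * b ^ (8 - 1) * -(b * t)) * ((a ^ 4 - b ^ 4) * a ^ 4) -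
      16 * b ^ 8 * ((((4 : ℕ) : ℝ) * a ^ (4 - 1) * (a * s) -
        ((4 : ℕ) : ℝ) * b ^ (4 - 1) * -(b * t)) * a ^ 4 +
        (a ^ 4 - b ^ 4) * (((4 : ℕ) : ℝ) * a ^ (4 - 1) * (a * s)))) /
      ((a ^ 4 - b ^ 4) * a ^ 4) ^ 2 = -24 * b ^ 4 / q := by
    have e1 : a ^ (4 - 1) * (a * s) = 2 * b ^ 4 * s := by rw [← hab]; ring
    rw [mul_assoc _ (a ^ (4 - 1)), e1, hab, hst]
    push_cast
    field_simp
    ring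
  rw [hnum, h4]
  field_simp
  norm_num
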